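/- Let φ be a flow on a compact metric space M. Suppose the nonwandering set Ω(φ) equals the pairwise disjoint union {σ_1} ∪ ⋯ ∪ {σ_l} ∪ H_1 ∪ ⋯ ∪ H_m, where each σ_i is a fixed point of φ, each H_j is a compact invariant transitive set, and each of the sets {σ_i} and H_j is isolated. If the set {x ∈ M : ω(x) is Lyapunov stable} is dense in M, then φ has finitely many attractors and the union of their basins is an open and dense subset of M. (Deterministic core of Theorem A of the paper.) -/

import Mathlib

open Set Filter Topology

variable {M : Type*}

/-- The ω-limit set of a point `x` under the flow `φ`: the set of points `y` such that
`φ^{t n}(x) → y` for some sequence `t n → ∞`. -/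
def omegaPt [TopologicalSpace M] (φ : Flow ℝ M) (x : M) : Set M :=
  {y | ∃ u : ℕ → ℝ, Tendsto u atTop atTop ∧
    Tendsto (fun n => φ.toFun (u n) x) atTop (𝓝 y)}

/-- A set `S` is invariant under the flow `φ` if `φ^t(S) = S` for all `t ∈ ℝ`. -/
def IsInvariantSet [TopologicalSpace M] (φ : Flow ℝ M) (S : Set M) : Prop :=
  ∀ t : ℝ, φ.toFun t '' S = S

/-- A set `Λ` is Lyapunov stable for `φ` if every neighborhood `U` of `Λ` contains a
neighborhood `V` of `Λ` with `φ^t(V) ⊆ U` for all `t ≥ 0`. -/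
def IsLyapunovStable [TopologicalSpace M] (φ : Flow ℝ M) (Λ : Set M) : Prop :=
  ∀ U ∈ 𝓝ˢ Λ, ∃ V ∈ 𝓝ˢ Λ, V ⊆ U ∧ ∀ t : ℝ, 0 ≤ t → φ.toFun t '' V ⊆ U

/-- A set `Λ` is isolated for `φ` if it has a neighborhood `U` (an isolating block) such that
`⋂_{t ∈ ℝ} φ^t(U) = Λ`. -/
def IsIsolatedSet [TopologicalSpace M] (φ : Flow ℝ M) (Λ : Set M) : Prop :=
  ∃ U ∈ 𝓝ˢ Λ, (⋂ t : ℝ, φ.toFun t '' U) = Λ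

/-- A set `Λ` is an attracting set for `φ` if it has a neighborhood `U` with `φ^t(U) ⊆ U` for
all `t > 0` and `⋂_{t ≥ 0} φ^t(U) = Λ`. -/
def IsAttractingSet [TopologicalSpace M] (φ : Flow ℝ M) (Λ : Set M) : Prop :=
  ∃ U ∈ 𝓝ˢ Λ, (∀ t : ℝ, 0 < t → φ.toFun t '' U ⊆ U) ∧
    (⋂ t ∈ Ici (0 : ℝ), φ.toFun t '' U) = Λ

/-- A compact invariant set `Λ` is transitive if `Λ = ω(p)` for some `p ∈ Λ`. -/
def IsTransitiveSet [TopologicalSpace M] (φ : Flow ℝ M) (Λ : Set M) : Prop :=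
  IsCompact Λ ∧ IsInvariantSet φ Λ ∧ ∃ p ∈ Λ, omegaPt φ p = Λ

/-- An attractor is a transitive set which is an attracting set. -/
def IsAttractor [TopologicalSpace M] (φ : Flow ℝ M) (Λ : Set M) : Prop :=
  IsTransitiveSet φ Λ ∧ IsAttractingSet φ Λ

/-- The nonwandering set of `φ`. -/
def nonwanderingSet [TopologicalSpace M] (φ : Flow ℝ M) : Set M :=
  {x | ∀ U ∈ 𝓝 x, ∀ T : ℝ, 0 < T → ∃ t : ℝ, T < t ∧ ((φ.toFun t '' U) ∩ U).Nonempty}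

section Flow

variable [MetricSpace M] {φ : Flow ℝ M}

theorem Flow.neg_apply_apply (φ : Flow ℝ M) (t : ℝ) (x : M) : φ (-t) (φ t x) = x := by
  rw [← φ.map_add, neg_add_cancel, φ.map_zero_apply]

theorem Flow.apply_neg_apply (φ : Flow ℝ M) (t : ℝ) (x : M) : φ t (φ (-t) x) = x := by
  rw [← φ.map_add, add_neg_cancel, φ.map_zero_apply]

theorem Flow.mem_image_iff (φ : Flow ℝ M) {t : ℝ} {S : Set M} {y : M} :
    y ∈ φ.toFun t '' S ↔ φ (-t) y ∈ S := by
  constructor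
  · rintro ⟨x, hx, rfl⟩
    rwa [φ.neg_apply_apply]
  · exact fun h => ⟨_, h, φ.apply_neg_apply t y⟩

theorem IsInvariantSet.apply_mem {S : Set M} (hS : IsInvariantSet φ S) (t : ℝ) {x : M}
    (hx : x ∈ S) : φ t x ∈ S := by
  rw [← hS t]
  exact mem_image_of_mem _ hx

theorem mem_omegaPt_iff {x y : M} :
    y ∈ omegaPt φ x ↔ MapClusterPt y atTop (fun t => φ t x) := by
  constructor
  · rintro ⟨u, hu, hy⟩
    exact MapClusterPt.of_comp hu hy.mapClusterPt
  · intro h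
    obtain ⟨u, hu, hu'⟩ := h.exists_seq_tendsto
    exact ⟨u, hu', hu⟩

theorem frequently_of_mem_omegaPt {x y : M} (hy : y ∈ omegaPt φ x) {U : Set M} (hU : U ∈ 𝓝 y) :
    ∃ᶠ t in atTop, φ t x ∈ U :=
  (mem_omegaPt_iff.1 hy).frequently hU

theorem omegaPt_subset_of_eventually {x : M} {K : Set M} (hK : IsClosed K)
    (h : ∀ᶠ t in atTop, φ t x ∈ K) : omegaPt φ x ⊆ K := by
  rintro y ⟨u, hu, hy⟩
  exact hK.mem_of_tendsto hy (hu.eventually h)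

theorem isClosed_omegaPt {x : M} : IsClosed (omegaPt φ x) := by
  have : omegaPt φ x = {y | ClusterPt y (map (fun t => φ t x) atTop)} := by
    ext y
    exact mem_omegaPt_iff
  rw [this]
  exact isClosed_setOfPred_clusterPt

theorem apply_mem_omegaPt {x y : M} (s : ℝ) (hy : y ∈ omegaPt φ x) : φ s y ∈ omegaPt φ x := by
  obtain ⟨u, hu, hy⟩ := hy
  refine ⟨fun n => s + u n, tendsto_atTop_add_const_left _ _ hu, ?_⟩
  simp only [φ.map_add]
  exact ((φ.continuous_toFun s).tendsto y).comp hy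

theorem omegaPt_subset_nonwanderingSet (x : M) : omegaPt φ x ⊆ nonwanderingSet φ := by
  intro y hy U hU T _
  have hf := frequently_of_mem_omegaPt hy hU
  obtain ⟨t, ht⟩ := hf.exists
  obtain ⟨s, hs, hst⟩ := (hf.and_eventually (eventually_gt_atTop (t + T))).exists
  refine ⟨s - t, by linarith, φ s x, φ.mem_image_iff.2 ?_, hs⟩
  rw [← φ.map_add]
  simpa using ht

/-- The points of a neighborhood `U` whose forward orbit stays in `U` form a trapping region,
so an isolated Lyapunov stable invariant set is attracting. -/
theorem IsLyapunovStable.isAttractingSet {Λ : Set M} (hs : IsLyapunovStable φ Λ)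
    (hinv : IsInvariantSet φ Λ) (hiso : IsIsolatedSet φ Λ) : IsAttractingSet φ Λ := by
  obtain ⟨U, hU, hUΛ⟩ := hiso
  obtain ⟨V, hV, -, hVU⟩ := hs U hU
  refine ⟨{y | ∀ t : ℝ, 0 ≤ t → φ t y ∈ U},
    mem_of_superset hV fun y hy t ht => hVU t ht (mem_image_of_mem _ hy), ?_, ?_⟩
  · rintro t ht _ ⟨y, hy, rfl⟩ s hs
    rw [← φ.map_add]
    exact hy _ (by positivity)
  · apply Subset.antisymm
    · intro y hy
      rw [← hUΛ]
      refine mem_iInter.2 fun t => φ.mem_image_iff.2 ?_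
      have h := φ.mem_image_iff.1 (mem_iInter₂.1 hy |t| (abs_nonneg t)) (|t| - t)
        (sub_nonneg.2 (le_abs_self t))
      rw [← φ.map_add] at h
      simpa [sub_eq_add_neg] using h
    · intro y hy
      exact mem_iInter₂.2 fun t _ => φ.mem_image_iff.2 fun s _ =>
        subset_of_mem_nhdsSet hU (hinv.apply_mem _ (hinv.apply_mem _ hy))

/-- If an ω-limit set meets a Lyapunov stable closed set, it is contained in it. -/
theorem IsLyapunovStable.omegaPt_subset {Λ : Set M} (hs : IsLyapunovStable φ Λ)
    (hΛ : IsClosed Λ) {p : M} (hne : (omegaPt φ p ∩ Λ).Nonempty) : omegaPt φ p ⊆ Λ := by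
  intro z hz
  by_contra hzΛ
  obtain ⟨U, V, hU, hV, hΛU, hzV, hUV⟩ := normal_separation hΛ (isClosed_singleton (x := z))
    (disjoint_singleton_right.2 hzΛ)
  obtain ⟨W, hW, -, hWU⟩ := hs U (hU.mem_nhdsSet.2 hΛU)
  obtain ⟨y, hy, hyΛ⟩ := hne
  obtain ⟨t, ht⟩ := (frequently_of_mem_omegaPt hy (mem_nhdsSet_iff_forall.1 hW y hyΛ)).exists
  have hVc : omegaPt φ p ⊆ Vᶜ := by
    refine omegaPt_subset_of_eventually hV.isClosed_compl
      (eventually_atTop.2 ⟨t, fun s hs => hUV.subset_compl_right ?_⟩)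
    have := hWU (s - t) (sub_nonneg.2 hs) (mem_image_of_mem _ ht)
    rw [← φ.map_add] at this
    simpa using this
  exact hVc hz (hzV rfl)

variable [CompactSpace M]

theorem omegaPt_nonempty (x : M) : (omegaPt φ x).Nonempty := by
  obtain ⟨y, hy⟩ := exists_clusterPt_of_compactSpace (map (fun t => φ t x) atTop)
  exact ⟨y, mem_omegaPt_iff.2 hy⟩

theorem eventually_of_omegaPt_subset {x : M} {U : Set M} (hU : IsOpen U)
    (h : omegaPt φ x ⊆ U) : ∀ᶠ t in atTop, φ t x ∈ U := by
  by_contra hn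
  obtain ⟨y, hy, hyc⟩ := hU.isClosed_compl.isCompact.exists_mapClusterPt_of_frequently
    (not_eventually.1 hn)
  exact hy (h (mem_omegaPt_iff.2 hyc))

/-- An ω-limit set contained in the union of two disjoint closed sets, and meeting the first,
is contained in the first. -/
theorem omegaPt_subset_left {x : M} {A B : Set M} (hA : IsClosed A) (hB : IsClosed B)
    (hAB : Disjoint A B) (h : omegaPt φ x ⊆ A ∪ B) (hne : (omegaPt φ x ∩ A).Nonempty) :
    omegaPt φ x ⊆ A := by
  obtain ⟨U, V, hU, hV, hAU, hBV, hUV⟩ := normal_separation hA hB hAB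
  obtain ⟨T, hT⟩ := eventually_atTop.1 (eventually_of_omegaPt_subset (hU.union hV)
    (h.trans (union_subset_union hAU hBV)))
  obtain ⟨y, hy, hyA⟩ := hne
  obtain ⟨t, htU, htT⟩ := ((frequently_of_mem_omegaPt hy (hU.mem_nhds (hAU hyA))).and_eventually
    (eventually_ge_atTop T)).exists
  have hcon : IsPreconnected ((fun t => φ t x) '' Ici T) :=
    isPreconnected_Ici.image _ (φ.continuous continuous_id continuous_const).continuousOn
  have hsub : (fun t => φ t x) '' Ici T ⊆ U :=
    hcon.subset_left_of_subset_union hU hV hUV (by rintro _ ⟨s, hs, rfl⟩; exact hT s hs)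
      ⟨_, ⟨t, htT, rfl⟩, htU⟩
  have hVc : omegaPt φ x ⊆ Vᶜ := omegaPt_subset_of_eventually hV.isClosed_compl
    (eventually_atTop.2 ⟨T, fun s hs => hUV.subset_compl_right (hsub ⟨s, hs, rfl⟩)⟩)
  exact fun z hz => (h hz).resolve_right fun hzB => hVc hz (hBV hzB)

/-- An attracting compact invariant set has arbitrarily small closed forward invariant
neighborhoods. -/
theorem IsAttractingSet.exists_isClosed_forwardInvariant {Λ : Set M} (ha : IsAttractingSet φ Λ)
    (hinv : IsInvariantSet φ Λ) (hΛ : IsCompact Λ) {N : Set M} (hN : N ∈ 𝓝ˢ Λ) :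
    ∃ C ∈ 𝓝ˢ Λ, IsClosed C ∧ C ⊆ N ∧ ∀ t : ℝ, 0 ≤ t → ∀ y ∈ C, φ t y ∈ C := by
  obtain ⟨U, hU, -, hUΛ⟩ := ha
  obtain ⟨O, hO, hΛO, hON⟩ := mem_nhdsSet_iff_exists.1 (inter_mem hU hN)
  obtain ⟨G, hG, hΛG, hGO⟩ := normal_exists_closure_subset hΛ.isClosed hO hΛO
  set K := closure G
  have hKU : K ⊆ U := fun y hy => (hON (hGO hy)).1
  let C : ℕ → Set M := fun n => {y | ∀ s ∈ Icc (0 : ℝ) n, φ (-s) y ∈ K}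
  have hCcl : ∀ n, IsClosed (C n) := fun n => by
    have : C n = ⋂ s ∈ Icc (0 : ℝ) n, φ (-s) ⁻¹' K := by ext; simp [C]
    rw [this]
    exact isClosed_biInter fun s _ => isClosed_closure.preimage (φ.continuous_toFun _)
  have hCanti : Antitone C := fun a b hab y hy s hs =>
    hy s ⟨hs.1, hs.2.trans (Nat.cast_le.2 hab)⟩
  have hCΛ : ⋂ n, C n ⊆ Λ := by
    intro y hy
    rw [← hUΛ]
    refine mem_iInter₂.2 fun t ht => φ.mem_image_iff.2 (hKU ?_)
    obtain ⟨n, hn⟩ := exists_nat_ge t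
    exact mem_iInter.1 hy n t ⟨ht, hn⟩
  obtain ⟨n, hn⟩ := exists_subset_nhds_of_isCompact hCanti.directed_ge
    (fun n => (hCcl n).isCompact) (fun y hy => hG.mem_nhds (hΛG (hCΛ hy)))
  have hCK : C n ⊆ K := hn.trans subset_closure
  refine ⟨C n, mem_nhdsSet_iff_forall.2 fun y hy => ?_, hCcl n,
    fun y hy => (hON (hGO (hCK hy))).2, ?_⟩
  · refine isCompact_Icc.eventually_forall_of_forall_eventually fun s _ => ?_
    have hc : Continuous fun z : M × ℝ => φ (-z.2) z.1 :=
      φ.continuous continuous_snd.neg continuous_fst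
    filter_upwards [hc.continuousAt.preimage_mem_nhds
      (hG.mem_nhds (hΛG (hinv.apply_mem (-s) hy)))] with z hz using subset_closure hz
  · intro t ht y hy
    have hcont : Continuous fun r => φ r y := φ.continuous continuous_id continuous_const
    have hind : Icc 0 t ⊆ (fun r => φ r y) ⁻¹' C n := by
      refine IsClosed.Icc_subset_of_forall_mem_nhdsWithin
        (((hCcl n).preimage hcont).inter isClosed_Icc) ?_ ?_
      · simpa using hy
      · rintro r ⟨hr, -⟩
        obtain ⟨b, hb, hbG⟩ := (mem_nhdsGE_iff_exists_Ico_subset).1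
          (mem_nhdsWithin_of_mem_nhds
            ((hG.preimage hcont).mem_nhds (show r ∈ (fun r => φ r y) ⁻¹' G from hn hr)))
        filter_upwards [Ioo_mem_nhdsGT hb] with q hq s hs
        change φ (-s) (φ q y) ∈ K
        rw [← φ.map_add]
        rcases le_total s (q - r) with h | h
        · exact subset_closure (hbG ⟨by linarith, by linarith [hs.1, hq.2]⟩)
        · have := hr (s - (q - r)) ⟨by linarith, by linarith [hs.2, hq.1]⟩
          rw [← φ.map_add] at this
          convert this using 2
          ring
    exact hind (right_mem_Icc.2 ht)

theorem IsAttractor.isLyapunovStable {Λ : Set M} (h : IsAttractor φ Λ) :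
    IsLyapunovStable φ Λ := by
  intro N hN
  obtain ⟨C, hC, -, hCN, hCf⟩ := h.2.exists_isClosed_forwardInvariant h.1.2.1 h.1.1 hN
  refine ⟨C, hC, hCN, ?_⟩
  rintro t ht _ ⟨y, hy, rfl⟩
  exact hCN (hCf t ht y hy)

theorem IsAttractor.isOpen_basin {Λ : Set M} (h : IsAttractor φ Λ) :
    IsOpen {x : M | omegaPt φ x ⊆ Λ} := by
  obtain ⟨U, hU, -, hUΛ⟩ := id h.2
  obtain ⟨C, hC, hCcl, hCU, hCf⟩ := h.2.exists_isClosed_forwardInvariant h.1.2.1 h.1.1 hU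
  rw [isOpen_iff_mem_nhds]
  intro x hx
  obtain ⟨T, hT⟩ := (eventually_of_omegaPt_subset isOpen_interior
    (hx.trans (subset_interior_iff_mem_nhdsSet.2 hC))).exists
  filter_upwards [(isOpen_interior.preimage (φ.continuous_toFun T)).mem_nhds hT] with y hy
  have hyC : omegaPt φ y ⊆ C := by
    refine omegaPt_subset_of_eventually hCcl (eventually_atTop.2 ⟨T, fun t ht => ?_⟩)
    have := hCf (t - T) (sub_nonneg.2 ht) _ (interior_subset hy)
    rw [← φ.map_add] at this
    simpa using this
  intro z hz
  rw [← hUΛ]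
  exact mem_iInter₂.2 fun t _ => φ.mem_image_iff.2 (hCU (hyC (apply_mem_omegaPt _ hz)))

/-- If the nonwandering set is a finite disjoint union of transitive sets, every Lyapunov stable
ω-limit set is one of them. -/
theorem omegaPt_eq_of_isLyapunovStable {ι : Type*} [Finite ι] {Λ : ι → Set M}
    (hΛ : ∀ i, IsTransitiveSet φ (Λ i)) (hdisj : Pairwise (Function.onFun Disjoint Λ))
    (hΩ : nonwanderingSet φ = ⋃ i, Λ i) {x : M} (hs : IsLyapunovStable φ (omegaPt φ x)) :
    ∃ i, omegaPt φ x = Λ i := by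
  have hsub : omegaPt φ x ⊆ ⋃ i, Λ i := hΩ ▸ omegaPt_subset_nonwanderingSet x
  obtain ⟨y, hy⟩ := omegaPt_nonempty (φ := φ) x
  obtain ⟨i, hi⟩ := mem_iUnion.1 (hsub hy)
  refine ⟨i, Subset.antisymm ?_ ?_⟩
  · refine omegaPt_subset_left (B := ⋃ j : {j // j ≠ i}, Λ j) (hΛ i).1.isClosed
      (isClosed_iUnion_of_finite fun j => (hΛ j).1.isClosed)
      (disjoint_iUnion_right.2 fun j => hdisj j.2.symm) (fun z hz => ?_) ⟨y, hy, hi⟩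
    obtain ⟨j, hj⟩ := mem_iUnion.1 (hsub hz)
    by_cases hji : j = i
    · exact Or.inl (hji ▸ hj)
    · exact Or.inr (mem_iUnion.2 ⟨⟨j, hji⟩, hj⟩)
  · obtain ⟨p, -, hp⟩ := (hΛ i).2.2
    rw [← hp]
    exact hs.omegaPt_subset isClosed_omegaPt ⟨y, hp.symm ▸ hi, hy⟩

/-- Version of the main theorem for an arbitrary finite family of basic sets. -/
theorem attractors_basins_of_iUnion {ι : Type*} [Finite ι] {Λ : ι → Set M}
    (hΛ : ∀ i, IsTransitiveSet φ (Λ i)) (hdisj : Pairwise (Function.onFun Disjoint Λ))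
    (hΩ : nonwanderingSet φ = ⋃ i, Λ i) (hiso : ∀ i, IsIsolatedSet φ (Λ i))
    (hdense : Dense {x : M | IsLyapunovStable φ (omegaPt φ x)}) :
    {Λ : Set M | IsAttractor φ Λ}.Finite ∧
    IsOpen {x : M | ∃ Λ : Set M, IsAttractor φ Λ ∧ omegaPt φ x ⊆ Λ} ∧
    Dense {x : M | ∃ Λ : Set M, IsAttractor φ Λ ∧ omegaPt φ x ⊆ Λ} := by
  refine ⟨(finite_range Λ).subset fun A hA => ?_, ?_, hdense.mono fun x hx => ?_⟩
  · have hst := hA.isLyapunovStable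
    obtain ⟨p, -, rfl⟩ := id hA.1.2.2
    obtain ⟨i, hi⟩ := omegaPt_eq_of_isLyapunovStable hΛ hdisj hΩ hst
    exact ⟨i, hi.symm⟩
  · have : {x : M | ∃ Λ : Set M, IsAttractor φ Λ ∧ omegaPt φ x ⊆ Λ} =
        ⋃ A ∈ {Λ : Set M | IsAttractor φ Λ}, {x : M | omegaPt φ x ⊆ A} := by
      ext x
      simp
    rw [this]
    exact isOpen_biUnion fun A hA => hA.isOpen_basin
  · obtain ⟨i, hi⟩ := omegaPt_eq_of_isLyapunovStable hΛ hdisj hΩ hx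
    have hst : IsLyapunovStable φ (Λ i) := hi ▸ hx
    exact ⟨Λ i, ⟨hΛ i, hst.isAttractingSet (hΛ i).2.1 (hiso i)⟩, hi.subset⟩

end Flow

theorem isTransitiveSet_singleton [MetricSpace M] {φ : Flow ℝ M} {x : M}
    (hx : ∀ t : ℝ, φ t x = x) : IsTransitiveSet φ {x} := by
  refine ⟨isCompact_singleton, fun t => by simp [hx t], x, rfl, ?_⟩
  apply Subset.antisymm
  · exact omegaPt_subset_of_eventually isClosed_singleton (Eventually.of_forall hx)
  · rintro _ rfl
    exact ⟨fun n => n, tendsto_natCast_atTop_atTop, by simp [hx]⟩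

/-- deterministic core of Theorem A: Suppose the nonwandering set of a
flow `φ` on a compact metric space is the pairwise disjoint union
`{σ 1} ∪ ⋯ ∪ {σ l} ∪ H 1 ∪ ⋯ ∪ H m`, where each `σ i` is a fixed point, each `H j` is a
compact invariant transitive set, and each of the sets `{σ i}` and `H j` is isolated.
If the set of points `x` with `ω(x)` Lyapunov stable is dense in `M`, then `φ` has finitely
many attractors and the union of their basins is open and dense in `M`. -/
theorem finitely_many_attractors_basins_open_dense
    [MetricSpace M] [CompactSpace M] (φ : Flow ℝ M)
    {l m : ℕ} (σ : Fin l → M) (H : Fin m → Set M)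
    (hσfix : ∀ i, ∀ t : ℝ, φ.toFun t (σ i) = σ i)
    (hHcomp : ∀ j, IsCompact (H j))
    (hHinv : ∀ j, IsInvariantSet φ (H j))
    (hHtrans : ∀ j, ∃ p ∈ H j, omegaPt φ p = H j)
    (hσinj : Function.Injective σ)
    (hσH : ∀ i j, σ i ∉ H j)
    (hHdisj : ∀ j j', j ≠ j' → Disjoint (H j) (H j'))
    (hΩ : nonwanderingSet φ = (⋃ i, {σ i}) ∪ ⋃ j, H j)
    (hσiso : ∀ i, IsIsolatedSet φ {σ i})
    (hHiso : ∀ j, IsIsolatedSet φ (H j))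
    (hdense : Dense {x : M | IsLyapunovStable φ (omegaPt φ x)}) :
    {Λ : Set M | IsAttractor φ Λ}.Finite ∧
    IsOpen {x : M | ∃ Λ : Set M, IsAttractor φ Λ ∧ omegaPt φ x ⊆ Λ} ∧
    Dense {x : M | ∃ Λ : Set M, IsAttractor φ Λ ∧ omegaPt φ x ⊆ Λ} := by
  refine attractors_basins_of_iUnion (Λ := Sum.elim (fun i => {σ i}) H) ?_ ?_ ?_ ?_ hdense
  · rintro (i | j)
    · exact isTransitiveSet_singleton (hσfix i)
    · exact ⟨hHcomp j, hHinv j, hHtrans j⟩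
  · rintro (i | i) (j | j) hij
    · simpa [Function.onFun] using fun h => hij (congrArg Sum.inl (hσinj h))
    · simpa [Function.onFun] using hσH i j
    · simpa [Function.onFun] using hσH j i
    · exact hHdisj i j fun h => hij (congrArg Sum.inr h)
  · simpa [iUnion_sum] using hΩ
  · rintro (i | j)
    · exact hσiso i
    · exact hHiso j
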